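/- There exists a constant C such that for all n ≥ 1, the number ℓ_n of labelled interval orders on {1, …, n} satisfies | ℓ_n / ( (n!)² · √n · (6/π²)^n ) − 12√3/π^{5/2} | ≤ C/n. In particular ℓ_n = (12√3/π^{5/2}) · (n!)² · √n · (6/π²)^n · (1 + O(1/n)). -/

import Mathlib

open scoped Classical

/-- An interval order on `Fin n`: a strict partial order with no induced `2+2`. -/
def IntervalOrderRel (n : ℕ) : Type :=
  {r : Fin n → Fin n → Prop // IsStrictOrder (Fin n) r ∧
    ∀ a b c d, r a b → r c d → r a d ∨ r c b}

/-- Two interval orders on `Fin n` are isomorphic if some permutation of the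
ground set transforms one into the other. -/
def IntervalOrderIso {n : ℕ} (P Q : IntervalOrderRel n) : Prop :=
  ∃ e : Equiv.Perm (Fin n), ∀ a b, P.1 a b ↔ Q.1 (e a) (e b)

/-- `i n`: the number of unlabelled interval orders on `n` points, i.e. the number
of isomorphism classes of interval orders on an `n`-element set. -/
noncomputable def intervalOrderCount (n : ℕ) : ℕ :=
  Nat.card (Quot (IntervalOrderIso (n := n)))

/-- A poset is rigid if its only (order) automorphism is the identity. -/
def IsRigid {n : ℕ} (P : IntervalOrderRel n) : Prop :=
  ∀ e : Equiv.Perm (Fin n), (∀ a b, P.1 a b ↔ P.1 (e a) (e b)) → e = 1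

/-- `r n`: the number of unlabelled rigid interval orders on `n` points. -/
noncomputable def rigidIntervalOrderCount (n : ℕ) : ℕ :=
  Nat.card (Quot fun (P Q : {P : IntervalOrderRel n // IsRigid P}) =>
    IntervalOrderIso P.1 Q.1)

/-- `ℓ n`: the number of labelled interval orders on an `n`-element set. -/
noncomputable def labelledIntervalOrderCount (n : ℕ) : ℕ :=
  Nat.card (IntervalOrderRel n)

/-- `x` and `y` are distinct elements with duplicated holdings:
`D(x) = D(y)` and `U(x) = U(y)`. -/
def DupHoldings {n : ℕ} (P : IntervalOrderRel n) (x y : Fin n) : Prop :=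
  x ≠ y ∧ (∀ z, P.1 z x ↔ P.1 z y) ∧ (∀ z, P.1 x z ↔ P.1 y z)

/-- The number of unordered pairs `{x, y}` of distinct elements with duplicated
holdings. -/
noncomputable def dupPairCount {n : ℕ} (P : IntervalOrderRel n) : ℕ :=
  Nat.card {s : Finset (Fin n) // ∃ x y, DupHoldings P x y ∧ s = {x, y}}

/-- `P` has three distinct elements pairwise having duplicated holdings. -/
def HasDupTriple {n : ℕ} (P : IntervalOrderRel n) : Prop :=
  ∃ x y z : Fin n, x ≠ y ∧ x ≠ z ∧ y ≠ z ∧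
    DupHoldings P x y ∧ DupHoldings P x z ∧ DupHoldings P y z

/-- The Stirling number of the second kind `S(n, k)`: the number of partitions
of an `n`-element set into `k` non-empty parts. -/
noncomputable def stirling2 (n k : ℕ) : ℕ :=
  Nat.card {P : Finpartition (Finset.univ : Finset (Fin n)) // P.parts.card = k}

section Representation

variable {n : ℕ}

/-- `f` assigns to every point the pair of endpoints of an interval in `{0, …, m - 1}` so that
each of `0, …, m - 1` is both a left endpoint and a right endpoint. -/
structure IsCanonicalRep (m : ℕ) (f : Fin n → ℕ × ℕ) : Prop where
  le : ∀ a, (f a).1 ≤ (f a).2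
  lt : ∀ a, (f a).2 < m
  exists_fst : ∀ i < m, ∃ a, (f a).1 = i
  exists_snd : ∀ i < m, ∃ a, (f a).2 = i

namespace IsCanonicalRep

variable {m m' : ℕ} {f f' : Fin n → ℕ × ℕ}

theorem size_le (h : IsCanonicalRep m f) (h' : IsCanonicalRep m' f) : m ≤ m' := by
  by_contra! hlt
  obtain ⟨a, ha⟩ := h.exists_fst m' hlt
  have := h'.le a
  have := h'.lt a
  lia

theorem size_unique (h : IsCanonicalRep m f) (h' : IsCanonicalRep m' f) : m = m' :=
  le_antisymm (h.size_le h') (h'.size_le h)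

theorem fst_le_fst_iff (h : IsCanonicalRep m f) (b c : Fin n) :
    (f b).1 ≤ (f c).1 ↔ ∀ a, (f a).2 < (f b).1 → (f a).2 < (f c).1 := by
  refine ⟨fun hbc a ha => ha.trans_le hbc, fun hbc => ?_⟩
  by_contra! hlt
  obtain ⟨a, ha⟩ := h.exists_snd (f c).1 ((h.le c).trans_lt (h.lt c))
  have := hbc a (ha ▸ hlt)
  lia

theorem fst_le_of_rel_iff (h : IsCanonicalRep m f) (h' : IsCanonicalRep m' f')
    (hrel : ∀ a b, (f a).2 < (f b).1 ↔ (f' a).2 < (f' b).1) (v : ℕ) :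
    ∀ b, (f b).1 = v → v ≤ (f' b).1 := by
  induction v with
  | zero => simp
  | succ v ih =>
    intro b hb
    obtain ⟨c, hc⟩ := h.exists_fst v (by have := h.le b; have := h.lt b; lia)
    have h1 := ih c hc
    have h2 : ¬ (f' b).1 ≤ (f' c).1 := by
      rw [h'.fst_le_fst_iff]
      simp only [← hrel]
      rw [← h.fst_le_fst_iff]
      lia
    lia

theorem fst_eq_of_rel_iff (h : IsCanonicalRep m f) (h' : IsCanonicalRep m' f')
    (hrel : ∀ a b, (f a).2 < (f b).1 ↔ (f' a).2 < (f' b).1) (b : Fin n) : (f b).1 = (f' b).1 :=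
  le_antisymm (h.fst_le_of_rel_iff h' hrel _ b rfl)
    (h'.fst_le_of_rel_iff h (fun a b => (hrel a b).symm) _ b rfl)

theorem snd_le_of_rel_iff (h : IsCanonicalRep m f) (h' : IsCanonicalRep m' f')
    (hrel : ∀ a b, (f a).2 < (f b).1 ↔ (f' a).2 < (f' b).1) (a : Fin n) : (f a).2 ≤ (f' a).2 := by
  by_contra! hlt
  obtain ⟨b, hb⟩ := h.exists_fst (f a).2 (h.lt a)
  have h1 := (hrel a b).mpr (by rw [← h.fst_eq_of_rel_iff h' hrel, hb]; exact hlt)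
  lia

theorem eq_of_rel_iff (h : IsCanonicalRep m f) (h' : IsCanonicalRep m' f')
    (hrel : ∀ a b, (f a).2 < (f b).1 ↔ (f' a).2 < (f' b).1) : f = f' :=
  funext fun a => Prod.ext (h.fst_eq_of_rel_iff h' hrel a)
    (le_antisymm (h.snd_le_of_rel_iff h' hrel a)
      (h'.snd_le_of_rel_iff h (fun a b => (hrel a b).symm) a))

/-- The interval order of a canonical representation. -/
def toRel (h : IsCanonicalRep m f) : IntervalOrderRel n :=
  ⟨fun a b => (f a).2 < (f b).1,
    { irrefl := fun a ha => by have := h.le a; lia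
      trans := fun a b c hab hbc => by have := h.le b; lia },
    fun a b c d hab hcd => by lia⟩

end IsCanonicalRep

namespace IntervalOrderRel

variable (P : IntervalOrderRel n)

/-- The set of elements below `b`. -/
noncomputable def down (b : Fin n) : Finset (Fin n) := {a | P.1 a b}

theorem mem_down {a b : Fin n} : a ∈ P.down b ↔ P.1 a b := by simp [down]

theorem notMem_down_self (a : Fin n) : a ∉ P.down a := by
  rw [mem_down]
  exact P.2.1.irrefl a

theorem down_subset_total (b c : Fin n) : P.down b ⊆ P.down c ∨ P.down c ⊆ P.down b := by
  by_contra! h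
  obtain ⟨⟨a, ha, ha'⟩, ⟨d, hd, hd'⟩⟩ := h.imp Finset.not_subset.mp Finset.not_subset.mp
  rw [mem_down] at ha ha' hd hd'
  rcases P.2.2 a b d c ha hd with h | h
  · exact ha' h
  · exact hd' h

/-- The collection of all sets of the form `P.down b`. -/
noncomputable def downs : Finset (Finset (Fin n)) := Finset.univ.image P.down

theorem down_mem_downs (b : Fin n) : P.down b ∈ P.downs :=
  Finset.mem_image_of_mem _ (Finset.mem_univ b)

/-- The canonical interval representation of an interval order. -/
noncomputable def rep (a : Fin n) : ℕ × ℕ :=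
  (({D ∈ P.downs | D ⊂ P.down a} : Finset _).card, ({D ∈ P.downs | a ∉ D} : Finset _).card - 1)

theorem rep_fst (a : Fin n) :
    (P.rep a).1 = ({D ∈ P.downs | D ⊂ P.down a} : Finset _).card := rfl

theorem rep_fst_lt_card (a b : Fin n) (h : a ∉ P.down b) :
    (P.rep b).1 < ({D ∈ P.downs | a ∉ D} : Finset _).card := by
  rw [rep_fst]
  refine Finset.card_lt_card ?_
  rw [Finset.ssubset_iff_of_subset]
  · exact ⟨P.down b, by simp [down_mem_downs, h], by simp⟩
  · intro D hD
    rw [Finset.mem_filter] at hD ⊢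
    exact ⟨hD.1, fun ha => h (hD.2.subset ha)⟩

theorem rep_snd_lt_rep_fst_iff (a b : Fin n) : (P.rep a).2 < (P.rep b).1 ↔ P.1 a b := by
  have hpos := P.rep_fst_lt_card a a (P.notMem_down_self a)
  have hsnd : (P.rep a).2 = ({D ∈ P.downs | a ∉ D} : Finset _).card - 1 := rfl
  constructor
  · intro h
    by_contra hab
    have := P.rep_fst_lt_card a b (by rwa [mem_down])
    lia
  · intro hab
    have : ({D ∈ P.downs | a ∉ D} : Finset _).card ≤ (P.rep b).1 := by
      rw [rep_fst]
      refine Finset.card_le_card fun D hD => ?_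
      rw [Finset.mem_filter] at hD ⊢
      refine ⟨hD.1, ?_⟩
      obtain ⟨c, -, rfl⟩ := Finset.mem_image.mp hD.1
      have hnot : ¬ P.down b ⊆ P.down c := fun h => hD.2 (h (P.mem_down.mpr hab))
      exact ⟨(P.down_subset_total c b).resolve_right hnot, hnot⟩
    lia

theorem rep_le (a : Fin n) : (P.rep a).1 ≤ (P.rep a).2 := by
  by_contra! h
  exact P.2.1.irrefl a ((P.rep_snd_lt_rep_fst_iff a a).mp h)

theorem rep_snd_lt (a : Fin n) : (P.rep a).2 < P.downs.card := by
  have hpos := P.rep_fst_lt_card a a (P.notMem_down_self a)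
  have hle : ({D ∈ P.downs | a ∉ D} : Finset _).card ≤ P.downs.card := Finset.card_filter_le _ _
  have hsnd : (P.rep a).2 = ({D ∈ P.downs | a ∉ D} : Finset _).card - 1 := rfl
  lia

theorem rep_exists_fst {i : ℕ} (hi : i < P.downs.card) : ∃ a, (P.rep a).1 = i := by
  set rank : Finset (Fin n) → ℕ := fun E => ({D ∈ P.downs | D ⊂ E} : Finset _).card with hrank
  have hlt {b c : Fin n} (h : P.down b ⊂ P.down c) : rank (P.down b) < rank (P.down c) := by
    refine Finset.card_lt_card ?_
    rw [Finset.ssubset_iff_of_subset]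
    · exact ⟨P.down b, by simp [down_mem_downs, h], by simp⟩
    · intro D hD
      rw [Finset.mem_filter] at hD ⊢
      exact ⟨hD.1, hD.2.trans h⟩
  have hmaps : Set.MapsTo rank P.downs (Finset.range P.downs.card) := by
    intro D hD
    obtain ⟨c, -, rfl⟩ := Finset.mem_image.mp (Finset.mem_coe.mp hD)
    rw [Finset.mem_coe, Finset.mem_range]
    exact (P.rep_le c).trans_lt (P.rep_snd_lt c)
  have hinj : Set.InjOn rank P.downs := by
    intro D hD E hE h
    obtain ⟨c, -, rfl⟩ := Finset.mem_image.mp (Finset.mem_coe.mp hD)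
    obtain ⟨d, -, rfl⟩ := Finset.mem_image.mp (Finset.mem_coe.mp hE)
    by_contra hne
    rcases P.down_subset_total c d with hs | hs
    · exact (hlt (hs.ssubset_of_ne hne)).ne h
    · exact (hlt (hs.ssubset_of_ne (Ne.symm hne))).ne h.symm
  obtain ⟨D, hD, hDi⟩ := Finset.surjOn_of_injOn_of_card_le rank hmaps hinj (by simp)
    (Finset.mem_coe.mpr (Finset.mem_range.mpr hi))
  obtain ⟨c, -, rfl⟩ := Finset.mem_image.mp (Finset.mem_coe.mp hD)
  exact ⟨c, hDi⟩

theorem isCanonicalRep_rep : IsCanonicalRep P.downs.card P.rep where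
  le := P.rep_le
  lt := P.rep_snd_lt
  exists_fst _ hi := P.rep_exists_fst hi
  exists_snd i hi := by
    obtain ⟨b, hb⟩ := P.rep_exists_fst hi
    rcases Nat.lt_or_ge (i + 1) P.downs.card with hi' | hi'
    · obtain ⟨c, hc⟩ := P.rep_exists_fst hi'
      have hsub : ¬ P.down c ⊆ P.down b := by
        intro h
        have : (P.rep c).1 ≤ (P.rep b).1 := by
          rw [rep_fst, rep_fst]
          refine Finset.card_le_card fun D hD => ?_
          rw [Finset.mem_filter] at hD ⊢
          exact ⟨hD.1, hD.2.trans_subset h⟩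
        lia
      obtain ⟨a, hac, hab⟩ := Finset.not_subset.mp hsub
      rw [mem_down, ← rep_snd_lt_rep_fst_iff] at hac hab
      exact ⟨a, by lia⟩
    · have := P.rep_le b
      have := P.rep_snd_lt b
      exact ⟨b, by lia⟩

theorem card_downs_le : P.downs.card ≤ n := by
  simpa [downs] using Finset.card_image_le (s := (Finset.univ : Finset (Fin n))) (f := P.down)

end IntervalOrderRel

/-- The canonical representations of length `m`. -/
noncomputable def canonicalReps (n m : ℕ) : Finset (Fin n → ℕ × ℕ) :=
  {f ∈ Fintype.piFinset fun _ : Fin n => Finset.range m ×ˢ Finset.range m | IsCanonicalRep m f}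

theorem mem_canonicalReps {m : ℕ} {f : Fin n → ℕ × ℕ} :
    f ∈ canonicalReps n m ↔ IsCanonicalRep m f := by
  rw [canonicalReps, Finset.mem_filter, and_iff_right_iff_imp]
  intro h
  simp only [Fintype.mem_piFinset, Finset.mem_product, Finset.mem_range]
  exact fun a => ⟨(h.le a).trans_lt (h.lt a), h.lt a⟩

theorem labelledIntervalOrderCount_eq_sum (n N : ℕ) (hN : n < N) :
    labelledIntervalOrderCount n = ∑ m ∈ Finset.range N, (canonicalReps n m).card := by
  rw [← Finset.card_biUnion, labelledIntervalOrderCount, ← Nat.card_eq_finsetCard]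
  · symm
    have hex (f : (Finset.range N).biUnion (canonicalReps n)) : ∃ m, IsCanonicalRep m f.1 := by
      obtain ⟨m, -, hm⟩ := Finset.mem_biUnion.mp f.2
      exact ⟨m, mem_canonicalReps.mp hm⟩
    refine Nat.card_eq_of_bijective (fun f => (hex f).choose_spec.toRel)
      ⟨fun f f' h => ?_, fun P => ?_⟩
    · refine Subtype.ext ((hex f).choose_spec.eq_of_rel_iff (hex f').choose_spec fun a b => ?_)
      exact iff_of_eq (congrFun (congrFun (congrArg Subtype.val h) a) b)
    · refine ⟨⟨P.rep, Finset.mem_biUnion.mpr ⟨P.downs.card, ?_, ?_⟩⟩, Subtype.ext ?_⟩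
      · exact Finset.mem_range.mpr (P.card_downs_le.trans_lt hN)
      · exact mem_canonicalReps.mpr P.isCanonicalRep_rep
      · funext a b
        exact propext (P.rep_snd_lt_rep_fst_iff a b)
  · intro m _ m' _ hne
    rw [Function.onFun, Finset.disjoint_left]
    intro f hf hf'
    exact hne ((mem_canonicalReps.mp hf).size_unique (mem_canonicalReps.mp hf'))

end Representation

/-- The weighted number of `m × (m + k)` upper triangular `0/1`-matrices in which no row and none
of the first `m` columns vanishes, each entry `1` having weight `p - 1`. -/
def triangularWeight {R : Type*} [CommRing R] (p : R) : ℕ → ℕ → R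
  | 0, _ => 1
  | m + 1, k =>
    (p ^ (k + 1) - 1) * triangularWeight p m (k + 1) - (p ^ k - 1) * triangularWeight p m k

section TriangularWeight

variable {R : Type*} [CommRing R]

theorem pow_dvd_triangularWeight {p t : R} (hp : t ∣ p - 1) (m k : ℕ) :
    t ^ m ∣ triangularWeight p m k := by
  induction m generalizing k with
  | zero => simp
  | succ m ih =>
    have h (j : ℕ) : t ∣ p ^ j - 1 := hp.trans (by simpa using sub_dvd_pow_sub_pow p 1 j)
    rw [triangularWeight, pow_succ']
    exact dvd_sub (mul_dvd_mul (h _) (ih _)) (mul_dvd_mul (h _) (ih _))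

theorem pow_mul_sum_triangularWeight (p : R) (M k : ℕ) :
    p ^ k * ∑ m ∈ Finset.range M, triangularWeight p m k =
      1 + (p ^ (k + 1) - 1) * ∑ m ∈ Finset.range M, triangularWeight p m (k + 1) -
        triangularWeight p M k := by
  have h := Finset.sum_range_succ (fun m => triangularWeight p m k) M
  rw [Finset.sum_range_succ'] at h
  simp only [triangularWeight, Finset.sum_sub_distrib, ← Finset.mul_sum] at h
  linear_combination -h

theorem pow_dvd_sum_triangularWeight_sub {p q t : R} (hpq : p * q = 1) (hp : t ∣ p - 1) (M : ℕ) :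
    t ^ M ∣ ∑ m ∈ Finset.range M, triangularWeight p m 0 -
      ∑ j ∈ Finset.range M, ∏ i ∈ Finset.range j, (1 - q ^ (i + 1)) := by
  set G : ℕ → R := fun k => ∑ m ∈ Finset.range M, triangularWeight p m k with hG
  have hpq' (k : ℕ) : p ^ k * q ^ k = 1 := by rw [← mul_pow, hpq, one_pow]
  have key (K : ℕ) : t ^ M ∣ G 0 - (∑ j ∈ Finset.range K, ∏ i ∈ Finset.range j, (1 - q ^ (i + 1)) +
      (∏ i ∈ Finset.range K, (1 - q ^ (i + 1))) * (p ^ K * G K)) := by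
    induction K with
    | zero => simp
    | succ K ih =>
      rw [Finset.sum_range_succ, Finset.prod_range_succ]
      have h := pow_mul_sum_triangularWeight p M K
      have h2 := (pow_dvd_triangularWeight hp M K).mul_left (∏ i ∈ Finset.range K, (1 - q ^ (i + 1)))
      refine (dvd_sub ih h2).trans (dvd_of_eq ?_)
      change p ^ K * G K = 1 + (p ^ (K + 1) - 1) * G (K + 1) - _ at h
      linear_combination -(∏ i ∈ Finset.range K, (1 - q ^ (i + 1))) * h -
        (∏ i ∈ Finset.range K, (1 - q ^ (i + 1))) * G (K + 1) * hpq' (K + 1)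
  have hq : t ∣ 1 - q := by
    have : (1 : R) - q = (p - 1) * q := by linear_combination -hpq
    rw [this]
    exact hp.mul_right q
  have hprod : t ^ M ∣ ∏ i ∈ Finset.range M, (1 - q ^ (i + 1)) := by
    have : t ^ M = ∏ _i ∈ Finset.range M, t := by simp
    rw [this]
    refine Finset.prod_dvd_prod_of_dvd _ _ fun i _ => hq.trans ?_
    simpa using sub_dvd_pow_sub_pow 1 q (i + 1)
  have h := dvd_add (key M) (hprod.mul_right (p ^ M * G M))
  convert h using 1
  ring

end TriangularWeight

/-- Partial sums of `∑ (xq; q)_n x ^ n`. -/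
def pochhammerSum {R : Type*} [CommRing R] (q x : R) (N : ℕ) : R :=
  ∑ n ∈ Finset.range N, (∏ i ∈ Finset.range n, (1 - x * q ^ (i + 1))) * x ^ n

theorem pow_dvd_pochhammerSum_functional {R : Type*} [CommRing R] {q x t : R}
    (ht : ∀ i : ℕ, t ∣ 1 - x * q ^ (i + 1)) (N : ℕ) :
    t ^ N ∣ (1 - x) * pochhammerSum q x N -
      (1 - x ^ 2 * q - x ^ 3 * q ^ 2 * ((1 - x * q) * pochhammerSum q (x * q) N)) := by
  have hprod : t ^ N ∣ ∏ i ∈ Finset.range N, (1 - x * q ^ (i + 1)) := by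
    have : t ^ N = ∏ _i ∈ Finset.range N, t := by simp
    rw [this]
    exact Finset.prod_dvd_prod_of_dvd _ _ fun i _ => ht i
  set P : ℕ → R := fun n => ∏ i ∈ Finset.range n, (1 - x * q ^ (i + 1)) with hP
  have hPs (n : ℕ) : P (n + 1) = P n * (1 - x * q ^ (n + 1)) := Finset.prod_range_succ _ _
  have hPs' (n : ℕ) : P (n + 1) = (1 - x * q) * ∏ i ∈ Finset.range n, (1 - x * q * q ^ (i + 1)) := by
    rw [hP]
    simp only [Finset.prod_range_succ', zero_add, pow_one]
    rw [mul_comm]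
    congr 1
    exact Finset.prod_congr rfl fun i _ => by ring
  have h1 : pochhammerSum q x N + P N * x ^ N = 1 + x * pochhammerSum q x N -
      x ^ 2 * q * ∑ n ∈ Finset.range N, P n * (x * q) ^ n := by
    have h := Finset.sum_range_succ (fun n => P n * x ^ n) N
    rw [Finset.sum_range_succ'] at h
    have h0 : P 0 = 1 := rfl
    rw [pochhammerSum, ← h, h0, Finset.mul_sum, Finset.mul_sum, add_sub_assoc,
      ← Finset.sum_sub_distrib, pow_zero, mul_one, add_comm]
    congr 1
    refine Finset.sum_congr rfl fun n _ => ?_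
    change P (n + 1) * x ^ (n + 1) = x * (P n * x ^ n) - _
    rw [hPs]
    ring
  have h2 : ∑ n ∈ Finset.range N, P n * (x * q) ^ n + P N * (x * q) ^ N =
      1 + x * q * ((1 - x * q) * pochhammerSum q (x * q) N) := by
    have h := Finset.sum_range_succ (fun n => P n * (x * q) ^ n) N
    rw [Finset.sum_range_succ'] at h
    have h0 : P 0 = 1 := rfl
    rw [pochhammerSum, ← h, h0, Finset.mul_sum, Finset.mul_sum, pow_zero, mul_one, add_comm]
    congr 1
    refine Finset.sum_congr rfl fun n _ => ?_
    rw [hPs']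
    ring
  refine (hprod.mul_left (x ^ 2 * q * (x * q) ^ N - x ^ N)).trans (dvd_of_eq ?_)
  linear_combination (x ^ 2 * q) * h2 - h1

/-- The Abel regularisation of `∑ χ₁₂(m) m ^ k`, in terms of Bernoulli polynomials. -/
noncomputable def abelMoment (k : ℕ) : ℝ :=
  -(12 : ℝ) ^ k / (k + 1) * (bernoulliFun (k + 1) (1 / 12) - bernoulliFun (k + 1) (5 / 12) -
    bernoulliFun (k + 1) (7 / 12) + bernoulliFun (k + 1) (11 / 12))

section AbelMoment

open PowerSeries in
theorem abelMoment_generating_function :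
    (mk fun k => abelMoment k / k.factorial) * (rescale 6 (exp ℝ) + 1) =
      exp ℝ - rescale 5 (exp ℝ) := by
  set B : ℝ → PowerSeries ℝ := fun t => rescale 12 (mk fun n => Polynomial.aeval t
    ((1 / n.factorial : ℚ) • Polynomial.bernoulli n)) with hB
  have hBt (a : ℝ) : B (a / 12) * (rescale 12 (exp ℝ) - 1) = C 12 * X * rescale a (exp ℝ) := by
    have h := congrArg (rescale (12 : ℝ)) (Polynomial.bernoulli_generating_function (a / 12))
    rw [map_mul, map_mul, map_sub, map_one, rescale_rescale, rescale_X] at h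
    rw [h]
    congr 3
    ring
  have hg : C 12 * X * (mk fun k => abelMoment k / k.factorial) =
      -(B (1 / 12) - B (5 / 12) - B (7 / 12) + B (11 / 12)) := by
    have hc (n : ℕ) (t : ℝ) : coeff n (B t) = 12 ^ n / n.factorial * bernoulliFun n t := by
      simp only [hB, coeff_rescale, coeff_mk, map_smul, bernoulliFun]
      rw [Polynomial.eval_map_algebraMap, Rat.smul_def]
      push_cast
      ring
    ext n
    rw [mul_assoc, coeff_C_mul]
    cases n with
    | zero =>
      simp only [coeff_zero_X_mul, mul_zero, map_neg, map_add, map_sub, hc, bernoulliFun_zero]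
      norm_num
    | succ n =>
      simp only [coeff_succ_X_mul, coeff_mk, map_neg, map_add, map_sub, hc, abelMoment,
        Nat.factorial_succ]
      have : (n.factorial : ℝ) ≠ 0 := by positivity
      have : (n : ℝ) + 1 ≠ 0 := by positivity
      push_cast
      field_simp
      ring
  have e7 : rescale 7 (exp ℝ) = exp ℝ * rescale 6 (exp ℝ) := by
    have := exp_mul_exp_eq_exp_add (1 : ℝ) 6
    norm_num at this
    exact this.symm
  have e11 : rescale 11 (exp ℝ) = rescale 5 (exp ℝ) * rescale 6 (exp ℝ) := by
    rw [exp_mul_exp_eq_exp_add]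
    norm_num
  have e12 : rescale 12 (exp ℝ) = rescale 6 (exp ℝ) * rescale 6 (exp ℝ) := by
    rw [exp_mul_exp_eq_exp_add]
    norm_num
  have h1 := hBt 1
  have h5 := hBt 5
  have h7 := hBt 7
  have h11 := hBt 11
  rw [e12] at h1 h5 h7 h11
  rw [e7] at h7
  rw [e11] at h11
  have e1 : rescale 1 (exp ℝ) = exp ℝ := by simp
  rw [e1] at h1
  have hne1 : C (12 : ℝ) * X ≠ 0 := by
    intro h
    have := congrArg (coeff 1) h
    rw [coeff_C_mul] at this
    simp at this
  have hne2 : rescale (6 : ℝ) (exp ℝ) - 1 ≠ 0 := by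
    intro h
    have := congrArg (coeff 1) h
    simp [coeff_exp, coeff_one] at this
  refine mul_left_cancel₀ (mul_ne_zero hne1 hne2) ?_
  linear_combination (rescale (6 : ℝ) (exp ℝ) - 1) * (rescale (6 : ℝ) (exp ℝ) + 1) * hg -
    h1 + h5 + h7 - h11

theorem abelMoment_add_shift (k : ℕ) :
    abelMoment k + ∑ j ∈ Finset.range (k + 1), 6 ^ (k - j) * k.choose j * abelMoment j =
      1 - 5 ^ k := by
  have h := congrArg (PowerSeries.coeff k) abelMoment_generating_function
  rw [mul_add, mul_one, map_add, map_sub, PowerSeries.coeff_mul,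
    Finset.Nat.sum_antidiagonal_eq_sum_range_succ_mk] at h
  simp only [PowerSeries.coeff_mk, PowerSeries.coeff_rescale, PowerSeries.coeff_exp] at h
  have hk : (k.factorial : ℝ) ≠ 0 := by positivity
  have h' := congrArg (fun z => (k.factorial : ℝ) * z) h
  simp only [mul_add, Finset.mul_sum] at h'
  calc _ = _ := ?_
    _ = _ := h'
    _ = _ := ?_
  · rw [add_comm]
    congr 1
    · refine Finset.sum_congr rfl fun j hj => ?_
      rw [Nat.cast_choose ℝ (Nat.lt_succ_iff.mp (Finset.mem_range.mp hj))]
      simp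
      ring
    · field_simp
  · simp
    field_simp

theorem abelMoment_two_mul (k : ℕ) : abelMoment (2 * k) = 0 := by
  have h (x : ℝ) : bernoulliFun (2 * k + 1) (1 - x) = -bernoulliFun (2 * k + 1) x := by
    rw [bernoulliFun_eval_one_sub, Odd.neg_one_pow ⟨k, rfl⟩]
    ring
  have h1 := h (1 / 12)
  have h5 := h (5 / 12)
  norm_num at h1 h5
  rw [abelMoment, h1, h5]
  ring

/-- `(-1) ^ (k + 1) * abelMoment (2 * k + 1)` is
`(2k+1)! (6 / π) ^ (2k+2) (√3 / 3 + O(4 ^ (-k)))`. -/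
theorem abs_abelMoment_sub_le (k : ℕ) :
    |(-1) ^ (k + 1) * abelMoment (2 * k + 1) -
      (2 * k + 1).factorial * (6 / Real.pi) ^ (2 * k + 2) * (Real.sqrt 3 / 3)| ≤
      (2 * k + 1).factorial * (6 / Real.pi) ^ (2 * k + 2) * ((1 / 4) ^ k * (Real.pi ^ 2 / 9)) := by
  set c : ℕ → ℝ := fun m => Real.cos (2 * Real.pi * m * (1 / 12)) -
    Real.cos (2 * Real.pi * m * (5 / 12)) - Real.cos (2 * Real.pi * m * (7 / 12)) +
    Real.cos (2 * Real.pi * m * (11 / 12)) with hc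
  have hcos {x : ℝ} (hx : x ∈ Set.Icc (0 : ℝ) 1) :=
    hasSum_one_div_nat_pow_mul_cos (k := k + 1) (Nat.succ_ne_zero k) hx
  have hs := (((hcos (x := 1 / 12) (by norm_num)).sub (hcos (x := 5 / 12) (by norm_num))).sub
    (hcos (x := 7 / 12) (by norm_num))).add (hcos (x := 11 / 12) (by norm_num))
  have hs' : HasSum (fun m : ℕ => 1 / (m : ℝ) ^ (2 * k + 2) * c m)
      ((-1) ^ (k + 1) * abelMoment (2 * k + 1) * 6 /
        ((2 * k + 1).factorial * (6 / Real.pi) ^ (2 * k + 2))) := by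
    convert! hs using 1
    · ext m
      ring
    · rw [abelMoment]
      change _ = _ * bernoulliFun (2 * k + 2) (1 / 12) - _ * bernoulliFun (2 * k + 2) (5 / 12) -
        _ * bernoulliFun (2 * k + 2) (7 / 12) + _ * bernoulliFun (2 * k + 2) (11 / 12)
      rw [show 2 * (k + 1) = 2 * k + 1 + 1 by ring, Nat.factorial_succ (2 * k + 1), div_pow, mul_pow,
        show (12 : ℝ) = 2 * 6 by norm_num, mul_pow]
      have : ((2 * k + 1).factorial : ℝ) ≠ 0 := by positivity
      have : (2 : ℝ) * k + 1 + 1 ≠ 0 := by positivity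
      push_cast
      field_simp
      ring
  have hc1 : c 1 = 2 * Real.sqrt 3 := by
    have h1 : 2 * Real.pi * (1 : ℕ) * (1 / 12) = Real.pi / 6 := by push_cast; ring
    have h5 : 2 * Real.pi * (1 : ℕ) * (5 / 12) = Real.pi - Real.pi / 6 := by push_cast; ring
    have h7 : 2 * Real.pi * (1 : ℕ) * (7 / 12) = Real.pi / 6 + Real.pi := by push_cast; ring
    have h11 : 2 * Real.pi * (1 : ℕ) * (11 / 12) = 2 * Real.pi - Real.pi / 6 := by
      push_cast; ring
    simp only [hc]
    rw [h1, h5, h7, h11, Real.cos_pi_sub, Real.cos_add_pi, Real.cos_two_pi_sub,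
      Real.cos_pi_div_six]
    ring
  have hc4 (m : ℕ) : |c m| ≤ 4 := by
    have h (x : ℝ) := abs_le.mp (Real.abs_cos_le_one x)
    simp only [hc]
    rw [abs_le]
    constructor <;>
    linarith [h (2 * Real.pi * m * (1 / 12)), h (2 * Real.pi * m * (5 / 12)),
      h (2 * Real.pi * m * (7 / 12)), h (2 * Real.pi * m * (11 / 12))]
  have hdiff := hs'.sub (hasSum_ite_eq (1 : ℕ) (2 * Real.sqrt 3))
  have hbound := (hasSum_zeta_two.mul_left (4 * (1 / 4 : ℝ) ^ k))
  have hle := hdiff.norm_le_of_bounded hbound fun m => by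
    rcases Nat.lt_or_ge m 2 with hm | hm
    · interval_cases m
      · simp
      · simp [hc1]
    · rw [if_neg (by lia), sub_zero, norm_mul, Real.norm_eq_abs, Real.norm_eq_abs,
        abs_of_nonneg (by positivity), mul_comm, mul_assoc]
      refine mul_le_mul (hc4 m) ?_ (by positivity) (by norm_num)
      have hm' : (2 : ℝ) ≤ m := by exact_mod_cast hm
      rw [div_pow, one_pow, div_mul_div_comm, one_mul]
      refine div_le_div_of_nonneg_left zero_le_one (by positivity) ?_
      rw [pow_add, pow_mul]
      gcongr
      nlinarith
  set D : ℝ := (2 * k + 1).factorial * (6 / Real.pi) ^ (2 * k + 2) with hD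
  have hDpos : 0 < D := by positivity
  have : (-1) ^ (k + 1) * abelMoment (2 * k + 1) - D * (Real.sqrt 3 / 3) = D / 6 *
      ((-1) ^ (k + 1) * abelMoment (2 * k + 1) * 6 / D - 2 * Real.sqrt 3) := by
    field_simp
    ring
  rw [this, abs_mul, abs_of_pos (by positivity), ← Real.norm_eq_abs]
  calc _ ≤ D / 6 * (4 * (1 / 4) ^ k * (Real.pi ^ 2 / 6)) := by gcongr
    _ = _ := by ring

end AbelMoment

section ExpSeries

open PowerSeries

variable {R S : Type*} [CommRing R] [Algebra ℚ R] [CommRing S] [Algebra ℚ S]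

/-- The power series `exp (a t)` in the variable `t`. -/
noncomputable def expSeries (a : R) : R⟦X⟧ := rescale a (exp R)

theorem coeff_expSeries (a : R) (n : ℕ) :
    coeff n (expSeries a) = a ^ n * algebraMap ℚ R (1 / n.factorial) := by
  rw [expSeries, coeff_rescale, coeff_exp]

theorem expSeries_add (a b : R) : expSeries (a + b) = expSeries a * expSeries b :=
  (exp_mul_exp_eq_exp_add a b).symm

theorem expSeries_zero : expSeries (0 : R) = 1 := by
  simp [expSeries]

theorem expSeries_nsmul (a : R) (k : ℕ) : expSeries (k * a) = expSeries a ^ k := by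
  induction k with
  | zero => simp [expSeries_zero]
  | succ k ih => rw [Nat.cast_succ, add_mul, one_mul, expSeries_add, ih, pow_succ]

theorem map_expSeries (f : R →+* S) (a : R) : map f (expSeries a) = expSeries (f a) := by
  ext n
  rw [coeff_map, coeff_expSeries, coeff_expSeries, map_mul, map_pow, RingHom.map_rat_algebraMap]

theorem X_dvd_one_sub_expSeries (a : R) : X ∣ 1 - expSeries a := by
  rw [X_dvd_iff, map_sub, ← coeff_zero_eq_constantCoeff_apply, ← coeff_zero_eq_constantCoeff_apply,
    coeff_expSeries]
  simp

theorem map_pochhammerSum {A B : Type*} [CommRing A] [CommRing B] (f : A →+* B) (q x : A) (N : ℕ) :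
    f (pochhammerSum q x N) = pochhammerSum (f q) (f x) N := by
  simp [pochhammerSum, map_sum, map_prod]

end ExpSeries

section AbelFunctional

open Polynomial

/-- The Abel regularisation of `p ↦ ∑ χ₁₂(m) p(m)` on polynomials. -/
noncomputable def abelFunctional (R : Type*) [CommRing R] [Algebra ℝ R] : R[X] →ₗ[R] R :=
  lsum fun k => abelMoment k • LinearMap.id

variable {R S : Type*} [CommRing R] [Algebra ℝ R] [CommRing S] [Algebra ℝ S]

theorem abelFunctional_monomial (k : ℕ) (a : R) :
    abelFunctional R (monomial k a) = abelMoment k • a := by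
  rw [abelFunctional, lsum_apply, sum_monomial_index] <;> simp

theorem abelFunctional_X_pow (k : ℕ) :
    abelFunctional R (X ^ k) = algebraMap ℝ R (abelMoment k) := by
  rw [← monomial_one_right_eq_X_pow, abelFunctional_monomial, Algebra.algebraMap_eq_smul_one]

theorem abelFunctional_map (f : R →ₐ[ℝ] S) (p : R[X]) :
    abelFunctional S (p.map (f : R →+* S)) = f (abelFunctional R p) := by
  induction p using Polynomial.induction_on' with
  | add p q hp hq => rw [Polynomial.map_add, map_add, map_add, map_add, hp, hq]
  | monomial k a => simp [abelFunctional_monomial]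

theorem abelFunctional_C_mul (a : R) (p : R[X]) :
    abelFunctional R (C a * p) = a * abelFunctional R p := by
  rw [C_mul', map_smul, smul_eq_mul]

theorem abelFunctional_add_shift (p : R[X]) :
    abelFunctional R p + abelFunctional R (p.comp (X + 6)) = p.eval 1 - p.eval 5 := by
  induction p using Polynomial.induction_on' with
  | add p q hp hq =>
    rw [add_comp, map_add, map_add, eval_add, eval_add]
    linear_combination hp + hq
  | monomial k a =>
    rw [← C_mul_X_pow_eq_monomial, mul_comp, C_comp, X_pow_comp, abelFunctional_C_mul,
      abelFunctional_C_mul, add_pow, map_sum, abelFunctional_X_pow]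
    have h := congrArg (algebraMap ℝ R) (abelMoment_add_shift k)
    simp only [map_add, map_sum, map_mul, map_sub, map_pow, map_natCast, map_ofNat, map_one] at h
    have h2 (j : ℕ) : abelFunctional R (X ^ j * 6 ^ (k - j) * (k.choose j : R[X])) =
        6 ^ (k - j) * k.choose j * algebraMap ℝ R (abelMoment j) := by
      have : (X ^ j * 6 ^ (k - j) * (k.choose j : R[X])) =
          C (6 ^ (k - j) * k.choose j : R) * X ^ j := by
        simp only [map_mul, map_pow, map_natCast, map_ofNat]
        ring
      rw [this, abelFunctional_C_mul, abelFunctional_X_pow]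
    simp only [h2, eval_mul, eval_C, eval_pow, eval_X, one_pow]
    linear_combination a * h

/-- In `R = ℝ[y]`, the coefficient of `y` in the regularisation of `(y α + β) ^ k`. -/
theorem coeff_one_abelFunctional_pow (α β : ℝ[X]) (k : ℕ) :
    (abelFunctional ℝ[X] ((C X * α.map C + β.map C) ^ k)).coeff 1 =
      k * abelFunctional ℝ (α * β ^ (k - 1)) := by
  have hmap (p : ℝ[X]) : abelFunctional ℝ[X] (p.map C) = C (abelFunctional ℝ p) :=
    abelFunctional_map (Algebra.ofId ℝ ℝ[X]) p
  have h (m : ℕ) : ((C X * α.map C) ^ m * β.map C ^ (k - m) * (k.choose m : ℝ[X][X])) =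
      C (X ^ m) * (α ^ m * β ^ (k - m) * (k.choose m : ℝ[X])).map C := by
    simp
    ring
  rw [add_pow, map_sum, finsetSum_coeff]
  simp only [h, abelFunctional_C_mul, hmap, coeff_mul_C, coeff_X_pow]
  rw [Finset.sum_eq_single 1]
  · have h2 : α ^ 1 * β ^ (k - 1) * (k.choose 1 : ℝ[X]) = C (k : ℝ) * (α * β ^ (k - 1)) := by
      simp
      ring
    rw [h2, abelFunctional_C_mul]
    simp
  · intro m _ hm
    simp [Ne.symm hm]
  · intro hk
    have : k = 0 := by simpa using hk
    simp [this]

end AbelFunctional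

section StrangeIdentity

open Polynomial

/-- The exponent of `q ^ (y (m - 1) / 2 + (m ^ 2 - 1) / 24)` for `q = exp (-t)`, as a polynomial
in `m` over `ℝ[y]`. -/
noncomputable def thetaExponent : ℝ[X][X] :=
  C X * (C (-1 / 2) * (X - 1) : ℝ[X]).map C + (C (-1 / 24) * (X ^ 2 - 1) : ℝ[X]).map C

/-- The regularised partial theta series `∑ χ₁₂(m) q ^ (y (m - 1) / 2 + (m ^ 2 - 1) / 24)`. -/
noncomputable def thetaSeries : PowerSeries ℝ[X] :=
  PowerSeries.mk fun d => abelFunctional ℝ[X] (PowerSeries.coeff d (expSeries thetaExponent))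

/-- The substitution `y ↦ y + 1`. -/
noncomputable def succHom : ℝ[X] →ₐ[ℝ] ℝ[X] := aeval (X + 1)

theorem thetaExponent_comp :
    thetaExponent.comp (X + 6) = C (-(3 * X + 2)) + thetaExponent.map (succHom : ℝ[X] →+* ℝ[X]) := by
  have h1 : (2 : ℝ[X][X]) * C (C (-1 / 2)) = -1 := by
    rw [← C_ofNat, ← C_mul, ← C_ofNat, ← C_mul]
    norm_num
  have h2 : (12 : ℝ[X][X]) * C (C (-1 / 24)) = C (C (-1 / 2)) := by
    rw [← C_ofNat, ← C_mul, ← C_ofNat, ← C_mul]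
    norm_num
  simp only [thetaExponent, Polynomial.map_add, Polynomial.map_sub, Polynomial.map_mul, map_C, map_X,
    Polynomial.map_pow, Polynomial.map_one, add_comp, sub_comp, mul_comp, C_comp, X_comp, pow_comp,
    one_comp, RingHom.coe_coe, succHom, aeval_X, aeval_C, map_neg, map_add, map_mul, map_ofNat,
    map_one, algebraMap_eq]
  linear_combination (3 * C X + 2) * h1 + (X + 3) * h2

theorem thetaSeries_functional :
    thetaSeries + expSeries (-(3 * X + 2)) *
      PowerSeries.map (succHom : ℝ[X] →+* ℝ[X]) thetaSeries = 1 - expSeries (-(2 * X + 1)) := by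
  have hshift : PowerSeries.map (compRingHom (X + 6)) (expSeries thetaExponent) =
      PowerSeries.map C (expSeries (-(3 * X + 2))) *
        PowerSeries.map (mapRingHom (succHom : ℝ[X] →+* ℝ[X])) (expSeries thetaExponent) := by
    rw [map_expSeries, map_expSeries, map_expSeries, coe_compRingHom_apply, thetaExponent_comp,
      expSeries_add, coe_mapRingHom]
  have heval (a : ℝ[X]) : PowerSeries.map (evalRingHom a) (expSeries thetaExponent) =
      expSeries (thetaExponent.eval a) := map_expSeries _ _
  have h1 : thetaExponent.eval 1 = 0 := by simp [thetaExponent]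
  have h5 : thetaExponent.eval 5 = -(2 * X + 1) := by
    have h1 : (2 : ℝ[X]) * C (-1 / 2) = -1 := by
      rw [← C_ofNat, ← C_mul]
      norm_num
    have h2 : (24 : ℝ[X]) * C (-1 / 24) = -1 := by
      rw [← C_ofNat, ← C_mul]
      norm_num
    simp only [thetaExponent, Polynomial.map_sub, Polynomial.map_mul, map_C, map_X,
      Polynomial.map_pow, Polynomial.map_one, eval_add, eval_sub, eval_mul, eval_C, eval_X, eval_pow,
      eval_one]
    linear_combination 2 * X * h1 + h2
  have hmul : expSeries (-(3 * X + 2)) * PowerSeries.map (succHom : ℝ[X] →+* ℝ[X]) thetaSeries =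
      PowerSeries.mk fun d => abelFunctional ℝ[X] (PowerSeries.coeff d
        (PowerSeries.map (compRingHom (X + 6)) (expSeries thetaExponent))) := by
    ext1 d
    rw [hshift, PowerSeries.coeff_mul, PowerSeries.coeff_mk, PowerSeries.coeff_mul, map_sum]
    refine Finset.sum_congr rfl fun ij _ => ?_
    rw [PowerSeries.coeff_map, PowerSeries.coeff_map, PowerSeries.coeff_map, abelFunctional_C_mul,
      coe_mapRingHom, abelFunctional_map, thetaSeries, PowerSeries.coeff_mk, RingHom.coe_coe]
  rw [hmul, ← h5, ← expSeries_zero, ← h1, ← heval, ← heval]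
  ext1 d
  rw [map_add, map_sub, PowerSeries.coeff_map, PowerSeries.coeff_map, thetaSeries,
    PowerSeries.coeff_mk, PowerSeries.coeff_mk, PowerSeries.coeff_map]
  exact abelFunctional_add_shift _

theorem eq_zero_of_add_succHom_eq_zero {p : ℝ[X]} (h : p + succHom p = 0) : p = 0 := by
  have hc : succHom p = p.comp (X + 1) := by simp [succHom, comp, aeval_def]
  have hl : (p.comp (X + C 1)).leadingCoeff = p.leadingCoeff := by
    rw [leadingCoeff_comp (by rw [natDegree_X_add_C]; exact one_ne_zero), leadingCoeff_X_add_C,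
      one_pow, mul_one]
  rw [map_one, ← hc, eq_neg_of_add_eq_zero_right h, leadingCoeff_neg] at hl
  rw [← leadingCoeff_eq_zero]
  linarith

theorem X_pow_dvd_of_dvd_add_expSeries_mul {D : PowerSeries ℝ[X]} {a : ℝ[X]} {N : ℕ}
    (h : PowerSeries.X ^ N ∣ D + expSeries a * PowerSeries.map (succHom : ℝ[X] →+* ℝ[X]) D) :
    PowerSeries.X ^ N ∣ D := by
  rw [PowerSeries.X_pow_dvd_iff] at h ⊢
  intro m
  induction m using Nat.strong_induction_on with
  | _ m ih =>
    intro hm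
    have h1 := h m hm
    rw [map_add, PowerSeries.coeff_mul, Finset.sum_eq_single (0, m)] at h1
    · rw [coeff_expSeries, PowerSeries.coeff_map] at h1
      exact eq_zero_of_add_succHom_eq_zero (by simpa using h1)
    · rintro ⟨i, j⟩ hij hne
      rw [Finset.HasAntidiagonal.mem_antidiagonal] at hij
      have : j < m := by
        rcases Nat.eq_zero_or_pos i with rfl | hi
        · exact absurd (by simpa using hij) (by simpa using hne)
        · simp only at hij
          lia
      rw [PowerSeries.coeff_map, ih j this (by lia), map_zero, mul_zero]
    · simp

theorem X_pow_dvd_thetaSeries_sub (N : ℕ) :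
    PowerSeries.X ^ N ∣ thetaSeries -
      (1 - expSeries (-X)) * pochhammerSum (expSeries (-1)) (expSeries (-X : ℝ[X])) N := by
  set q : PowerSeries ℝ[X] := expSeries (-1) with hq
  set x : PowerSeries ℝ[X] := expSeries (-X) with hx
  have hxq (i : ℕ) : x * q ^ i = expSeries (-X - (i : ℝ[X])) := by
    rw [hx, hq, ← expSeries_nsmul, ← expSeries_add]
    congr 1
    ring
  have hmq : PowerSeries.map (succHom : ℝ[X] →+* ℝ[X]) q = q := by
    rw [hq, map_expSeries]
    simp
  have hmx : PowerSeries.map (succHom : ℝ[X] →+* ℝ[X]) x = x * q := by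
    have := hxq 1
    rw [pow_one] at this
    rw [this, hx, map_expSeries]
    congr 1
    simp [succHom]
    ring
  have h2 : x ^ 2 * q = expSeries (-(2 * X + 1)) := by
    rw [hx, hq, ← expSeries_nsmul, ← expSeries_add]
    congr 1
    push_cast
    ring
  have h3 : x ^ 3 * q ^ 2 = expSeries (-(3 * X + 2)) := by
    rw [hx, hq, ← expSeries_nsmul, ← expSeries_nsmul, ← expSeries_add]
    congr 1
    push_cast
    ring
  refine X_pow_dvd_of_dvd_add_expSeries_mul (a := -(3 * X + 2)) ?_
  have hpoch := pow_dvd_pochhammerSum_functional (q := q) (x := x) (t := PowerSeries.X)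
    (fun i => by rw [hxq]; exact X_dvd_one_sub_expSeries _) N
  rw [← dvd_neg] at hpoch
  refine hpoch.trans (dvd_of_eq ?_)
  rw [map_sub, map_mul, map_sub, map_one, map_pochhammerSum, hmx, hmq, h2, h3]
  linear_combination -thetaSeries_functional

theorem coeff_sum_prod_one_sub (n N : ℕ) (hN : n + 2 ≤ N) :
    PowerSeries.coeff n (∑ j ∈ Finset.range N, ∏ i ∈ Finset.range j,
      (1 - expSeries (-1 : ℝ) ^ (i + 1))) =
      abelFunctional ℝ (C (-1 / 2) * (X - 1) * (C (-1 / 24) * (X ^ 2 - 1)) ^ n) / n.factorial := by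
  have h := PowerSeries.X_pow_dvd_iff.mp (X_pow_dvd_thetaSeries_sub N) (n + 1) (by lia)
  rw [map_sub, sub_eq_zero] at h
  replace h := congrArg (fun p : ℝ[X] => p.coeff 1) h
  have hleft : (PowerSeries.coeff (n + 1) thetaSeries).coeff 1 =
      abelFunctional ℝ (C (-1 / 2) * (X - 1) * (C (-1 / 24) * (X ^ 2 - 1)) ^ n) / n.factorial := by
    have hC : (algebraMap ℚ ℝ[X][X]) (1 / ((n + 1).factorial : ℚ)) =
        C (C (1 / ((n + 1).factorial : ℝ))) := by
      rw [IsScalarTower.algebraMap_apply ℚ ℝ[X] ℝ[X][X], IsScalarTower.algebraMap_apply ℚ ℝ ℝ[X]]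
      simp
    rw [thetaSeries, PowerSeries.coeff_mk, coeff_expSeries, hC, mul_comm, abelFunctional_C_mul,
      coeff_C_mul, thetaExponent, coeff_one_abelFunctional_pow, Nat.add_sub_cancel,
      Nat.factorial_succ]
    have : (n.factorial : ℝ) ≠ 0 := by positivity
    push_cast
    field_simp
  have hright (A : PowerSeries ℝ[X]) :
      (PowerSeries.coeff (n + 1) ((1 - expSeries (-X)) * A)).coeff 1 =
        PowerSeries.coeff n (PowerSeries.map (evalRingHom 0) A) := by
    have hc (i : ℕ) : PowerSeries.coeff i (expSeries (-X : ℝ[X])) =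
        C ((-1) ^ i / i.factorial : ℝ) * X ^ i := by
      rw [coeff_expSeries, IsScalarTower.algebraMap_apply ℚ ℝ ℝ[X], algebraMap_eq, neg_pow,
        div_eq_mul_inv ((-1 : ℝ) ^ i), C_mul]
      simp
    have h0 (i : ℕ) : (PowerSeries.coeff i (1 - expSeries (-X : ℝ[X]))).coeff 0 = 0 := by
      rw [map_sub, hc, PowerSeries.coeff_one, coeff_sub, coeff_C_mul, coeff_X_pow]
      rcases i with _ | i <;> simp
    have h1 (i : ℕ) : (PowerSeries.coeff i (1 - expSeries (-X : ℝ[X]))).coeff 1 =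
        if i = 1 then 1 else 0 := by
      rw [map_sub, hc, PowerSeries.coeff_one, coeff_sub, coeff_C_mul, coeff_X_pow]
      rcases i with _ | _ | i <;> simp [coeff_one]
    rw [PowerSeries.coeff_mul, finsetSum_coeff]
    simp only [mul_coeff_one, h0, h1, zero_mul, zero_add]
    rw [Finset.sum_eq_single (1, n)]
    · simp [coeff_zero_eq_eval_zero]
    · rintro ⟨i, j⟩ hij hne
      rw [Finset.HasAntidiagonal.mem_antidiagonal] at hij
      simp only at hij ⊢
      rw [if_neg, zero_mul]
      rintro rfl
      exact hne (by simp; lia)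
    · simp [add_comm]
  rw [← hleft, h, hright, map_pochhammerSum, map_expSeries, map_expSeries, pochhammerSum]
  simp [expSeries_zero]

theorem abelFunctional_theta (n : ℕ) :
    abelFunctional ℝ (C (-1 / 2) * (X - 1) * (C (-1 / 24) * (X ^ 2 - 1)) ^ n) =
      (∑ j ∈ Finset.range (n + 1), n.choose j * ((-1) ^ (j + 1) * abelMoment (2 * j + 1))) /
        (2 * 24 ^ n) := by
  have h : C (-1 / 2) * (X - 1) * (C (-1 / 24) * (X ^ 2 - 1)) ^ n =
      ∑ j ∈ Finset.range (n + 1),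
        C (1 / (2 * 24 ^ n) * n.choose j * (-1) ^ (j + 1) : ℝ) * (X ^ (2 * j + 1) - X ^ (2 * j)) := by
    rw [mul_pow, sub_eq_add_neg (X ^ 2), add_pow, Finset.mul_sum, Finset.mul_sum]
    refine Finset.sum_congr rfl fun j hj => ?_
    obtain ⟨i, rfl⟩ := Nat.exists_eq_add_of_le (Nat.lt_succ_iff.mp (Finset.mem_range.mp hj))
    have hc : C (-1 / 2) * C (-1 / 24) ^ (j + i) * (-1) ^ i * ((j + i).choose j : ℝ[X]) =
        C (1 / (2 * 24 ^ (j + i)) * (j + i).choose j * (-1) ^ (j + 1) : ℝ) := by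
      have h1 : (-1 : ℝ[X]) = C (-1) := by simp
      rw [h1, ← C_pow, ← C_pow, ← C_eq_natCast, ← C_mul, ← C_mul, ← C_mul]
      congr 1
      have h2 : (-1 : ℝ) ^ i * (-1) ^ i = 1 := by rw [← mul_pow]; simp
      rw [div_pow, pow_add (-1 : ℝ)]
      linear_combination (-1 / 2 * ((-1) ^ j / 24 ^ (j + i)) * (j + i).choose j) * h2
    rw [← hc, Nat.add_sub_cancel_left]
    ring
  rw [h, map_sum, Finset.sum_div]
  refine Finset.sum_congr rfl fun j _ => ?_
  rw [abelFunctional_C_mul, map_sub, abelFunctional_X_pow, abelFunctional_X_pow, abelMoment_two_mul]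
  simp
  ring

end StrangeIdentity

section Counting

/-- `S` is a set of cells `(i, j)` with `i < m`, `i ≤ j` and `j < m` or `j ∈ J`, meeting every row
`i < m` and every column `j < m`. -/
structure IsTriangularCover (m : ℕ) (J : Finset ℕ) (S : Finset (ℕ × ℕ)) : Prop where
  fst_lt : ∀ c ∈ S, c.1 < m
  fst_le : ∀ c ∈ S, c.1 ≤ c.2
  snd_mem : ∀ c ∈ S, c.2 < m ∨ c.2 ∈ J
  exists_fst : ∀ i < m, ∃ c ∈ S, c.1 = i
  exists_snd : ∀ j < m, ∃ c ∈ S, c.2 = j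

/-- The finite set of all triangular covers. -/
noncomputable def triangularCovers (m : ℕ) (J : Finset ℕ) : Finset (Finset (ℕ × ℕ)) :=
  {S ∈ (Finset.range m ×ˢ (Finset.range m ∪ J)).powerset | IsTriangularCover m J S}

theorem mem_triangularCovers {m : ℕ} {J : Finset ℕ} {S : Finset (ℕ × ℕ)} :
    S ∈ triangularCovers m J ↔ IsTriangularCover m J S := by
  rw [triangularCovers, Finset.mem_filter, and_iff_right_iff_imp]
  intro h
  rw [Finset.mem_powerset]
  intro c hc
  rw [Finset.mem_product, Finset.mem_union, Finset.mem_range, Finset.mem_range]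
  exact ⟨h.fst_lt c hc, h.snd_mem c hc⟩

theorem triangularCovers_mono {m : ℕ} {J K : Finset ℕ} (h : J ⊆ K) :
    triangularCovers m J ⊆ triangularCovers m K := by
  intro S hS
  rw [mem_triangularCovers] at hS ⊢
  exact ⟨hS.1, hS.2, fun c hc => (hS.3 c hc).imp_right fun hJ => h hJ, hS.4, hS.5⟩

theorem triangularCovers_zero (J : Finset ℕ) : triangularCovers 0 J = {∅} := by
  ext S
  rw [mem_triangularCovers, Finset.mem_singleton]
  constructor
  · intro h
    exact Finset.eq_empty_of_forall_notMem fun c hc => absurd (h.fst_lt c hc) (Nat.not_lt_zero _)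
  · rintro rfl
    constructor <;> simp

/-- Adjoin the cells of `B` in row `m`. -/
noncomputable def adjoinRow (m : ℕ) (x : Finset (ℕ × ℕ) × Finset ℕ) : Finset (ℕ × ℕ) :=
  x.1 ∪ x.2.image (Prod.mk m)

theorem mem_adjoinRow {m : ℕ} {S : Finset (ℕ × ℕ)} {B : Finset ℕ} {c : ℕ × ℕ} :
    c ∈ adjoinRow m (S, B) ↔ c ∈ S ∨ c.1 = m ∧ c.2 ∈ B := by
  obtain ⟨i, j⟩ := c
  simp only [adjoinRow, Finset.mem_union, Finset.mem_image, Prod.mk.injEq]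
  grind

theorem card_adjoinRow {m : ℕ} {S : Finset (ℕ × ℕ)} (hS : ∀ c ∈ S, c.1 < m) (B : Finset ℕ) :
    (adjoinRow m (S, B)).card = S.card + B.card := by
  rw [adjoinRow, Finset.card_union_of_disjoint, Finset.card_image_of_injective _
    (Prod.mk_right_injective m)]
  rw [Finset.disjoint_left]
  intro c hc hc'
  obtain ⟨j, -, rfl⟩ := Finset.mem_image.mp hc'
  exact (hS _ hc).ne rfl

theorem adjoinRow_mem_iff {m : ℕ} {J : Finset ℕ} (hJ : ∀ j ∈ J, m + 1 ≤ j)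
    {S : Finset (ℕ × ℕ)} {B : Finset ℕ} (hS : ∀ c ∈ S, c.1 < m) :
    adjoinRow m (S, B) ∈ triangularCovers (m + 1) J ↔
      (S, B) ∈ triangularCovers m (insert m J) ×ˢ (insert m J).powerset.erase ∅ \
        triangularCovers m J ×ˢ J.powerset.erase ∅ := by
  simp only [Finset.mem_sdiff, Finset.mem_product, Finset.mem_erase, Finset.mem_powerset,
    mem_triangularCovers]
  constructor
  · intro h
    have hB : ∀ j ∈ B, j = m ∨ j ∈ J := by
      intro j hj
      have hmem : (m, j) ∈ adjoinRow m (S, B) := mem_adjoinRow.mpr (.inr ⟨rfl, hj⟩)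
      have h1 := h.fst_le _ hmem
      have h2 := h.snd_mem _ hmem
      dsimp only at h1 h2
      grind
    refine ⟨⟨⟨hS, ?_, ?_, ?_, ?_⟩, ?_, ?_⟩, ?_⟩
    · exact fun c hc => h.fst_le c (mem_adjoinRow.mpr (.inl hc))
    · intro c hc
      have := h.snd_mem c (mem_adjoinRow.mpr (.inl hc))
      grind
    · intro i hi
      obtain ⟨c, hc, rfl⟩ := h.exists_fst i (by lia)
      exact ⟨c, (mem_adjoinRow.mp hc).resolve_right (by lia), rfl⟩
    · intro j hj
      obtain ⟨c, hc, rfl⟩ := h.exists_snd j (by lia)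
      refine ⟨c, (mem_adjoinRow.mp hc).resolve_right ?_, rfl⟩
      have := h.fst_le c hc
      lia
    · obtain ⟨c, hc, hcm⟩ := h.exists_fst m (by lia)
      rcases mem_adjoinRow.mp hc with hc | hc
      · exact absurd hcm (hS c hc).ne
      · exact Finset.ne_empty_of_mem hc.2
    · intro j hj
      simpa using hB j hj
    · rintro ⟨hSJ, -, hBJ⟩
      obtain ⟨c, hc, hcm⟩ := h.exists_snd m (by lia)
      rcases mem_adjoinRow.mp hc with hc | hc
      · have := hSJ.snd_mem c hc
        grind
      · have := hJ _ (hBJ hc.2)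
        lia
  · rintro ⟨⟨h, hne, hB⟩, hnot⟩
    refine ⟨?_, ?_, ?_, ?_, ?_⟩
    · intro c hc
      rcases mem_adjoinRow.mp hc with hc | hc
      · exact (hS c hc).trans (by lia)
      · lia
    · intro c hc
      rcases mem_adjoinRow.mp hc with hc | hc
      · exact h.fst_le c hc
      · have := hB hc.2
        grind
    · intro c hc
      rcases mem_adjoinRow.mp hc with hc | hc
      · have := h.snd_mem c hc
        grind
      · have := hB hc.2
        grind
    · intro i hi
      rcases Nat.lt_succ_iff_lt_or_eq.mp hi with hi | rfl
      · obtain ⟨c, hc, rfl⟩ := h.exists_fst i hi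
        exact ⟨c, mem_adjoinRow.mpr (.inl hc), rfl⟩
      · obtain ⟨j, hj⟩ := Finset.nonempty_iff_ne_empty.mpr hne
        exact ⟨(i, j), mem_adjoinRow.mpr (.inr ⟨rfl, hj⟩), rfl⟩
    · intro j hj
      rcases Nat.lt_succ_iff_lt_or_eq.mp hj with hj | rfl
      · obtain ⟨c, hc, rfl⟩ := h.exists_snd j hj
        exact ⟨c, mem_adjoinRow.mpr (.inl hc), rfl⟩
      · by_contra! hcol
        have hcol' : ∀ c ∈ S, c.2 ≠ j := fun c hc => hcol c (mem_adjoinRow.mpr (.inl hc))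
        refine hnot ⟨⟨h.1, h.2, ?_, h.4, h.5⟩, hne, ?_⟩
        · intro c hc
          have := h.snd_mem c hc
          have := hcol' c hc
          grind
        · intro i hi
          have := hB hi
          have := hcol (j, i) (mem_adjoinRow.mpr (.inr ⟨rfl, hi⟩))
          grind

/-- The part of `S` above row `m`, together with row `m` itself. -/
noncomputable def splitRow (m : ℕ) (S : Finset (ℕ × ℕ)) : Finset (ℕ × ℕ) × Finset ℕ :=
  (S.filter fun c => c.1 < m, (S.filter fun c => c.1 = m).image Prod.snd)

theorem adjoinRow_splitRow {m : ℕ} {S : Finset (ℕ × ℕ)} (hS : ∀ c ∈ S, c.1 < m + 1) :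
    adjoinRow m (splitRow m S) = S := by
  ext ⟨i, j⟩
  have := hS (i, j)
  rw [splitRow, mem_adjoinRow]
  simp only [Finset.mem_filter, Finset.mem_image, Prod.exists, exists_eq_right] at this ⊢
  grind

theorem splitRow_adjoinRow {m : ℕ} {S : Finset (ℕ × ℕ)} (hS : ∀ c ∈ S, c.1 < m) (B : Finset ℕ) :
    splitRow m (adjoinRow m (S, B)) = (S, B) := by
  refine Prod.ext ?_ ?_
  · ext c
    simp only [splitRow, Finset.mem_filter, mem_adjoinRow]
    have := hS c
    grind
  · ext j
    simp only [splitRow, Finset.mem_filter, Finset.mem_image, mem_adjoinRow, Prod.exists,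
      exists_eq_right]
    have := hS (m, j)
    grind

theorem sum_triangularCovers_succ {M : Type*} [AddCommMonoid M] {m : ℕ} {J : Finset ℕ}
    (hJ : ∀ j ∈ J, m + 1 ≤ j) (g : Finset (ℕ × ℕ) → M) :
    ∑ S ∈ triangularCovers (m + 1) J, g S =
      ∑ x ∈ triangularCovers m (insert m J) ×ˢ (insert m J).powerset.erase ∅ \
        triangularCovers m J ×ˢ J.powerset.erase ∅, g (adjoinRow m x) := by
  have hinv (S) (hS : S ∈ triangularCovers (m + 1) J) : adjoinRow m (splitRow m S) = S :=
    adjoinRow_splitRow (mem_triangularCovers.mp hS).fst_lt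
  have hrow (x) (hx : x ∈ triangularCovers m (insert m J) ×ˢ (insert m J).powerset.erase ∅ \
      triangularCovers m J ×ˢ J.powerset.erase ∅) : ∀ c ∈ x.1, c.1 < m :=
    (mem_triangularCovers.mp (Finset.mem_product.mp (Finset.mem_sdiff.mp hx).1).1).fst_lt
  refine Finset.sum_nbij' (splitRow m) (adjoinRow m) (fun S hS => ?_)
    (fun x hx => (adjoinRow_mem_iff hJ (hrow x hx)).mpr hx) hinv
    (fun x hx => splitRow_adjoinRow (hrow x hx) x.2) (fun S hS => by rw [hinv S hS])
  refine (adjoinRow_mem_iff hJ (fun c hc => (Finset.mem_filter.mp hc).2)).mp ?_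
  exact (hinv S hS).symm ▸ hS

variable {R : Type*} [CommRing R]

theorem sum_powerset_erase_empty_pow (p : R) (K : Finset ℕ) :
    ∑ B ∈ K.powerset.erase ∅, (p - 1) ^ B.card = p ^ K.card - 1 := by
  have h := Finset.sum_pow_mul_eq_add_pow (p - 1) 1 K
  rw [← Finset.add_sum_erase _ _ (Finset.empty_mem_powerset K)] at h
  simp only [one_pow, mul_one, Finset.card_empty, pow_zero, sub_add_cancel] at h
  rw [← h]
  ring

theorem sum_triangularCovers_pow (p : R) (m : ℕ) :
    ∀ J : Finset ℕ, (∀ j ∈ J, m ≤ j) →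
      ∑ S ∈ triangularCovers m J, (p - 1) ^ S.card = triangularWeight p m J.card := by
  induction m with
  | zero =>
    intro J _
    simp [triangularCovers_zero, triangularWeight]
  | succ m ih =>
    intro J hJ
    have hm : m ∉ J := fun h => by have := hJ m h; lia
    have hsub : triangularCovers m J ×ˢ J.powerset.erase ∅ ⊆
        triangularCovers m (insert m J) ×ˢ (insert m J).powerset.erase ∅ :=
      Finset.product_subset_product (triangularCovers_mono (Finset.subset_insert m J))
        (Finset.erase_subset_erase _ (Finset.powerset_mono.mpr (Finset.subset_insert m J)))
    have hsum (K : Finset ℕ) (hK : ∀ j ∈ K, m ≤ j) :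
        ∑ x ∈ triangularCovers m K ×ˢ K.powerset.erase ∅, (p - 1) ^ (adjoinRow m x).card =
          (p ^ K.card - 1) * triangularWeight p m K.card := by
      rw [Finset.sum_product, ← ih K hK, ← sum_powerset_erase_empty_pow, mul_comm,
        Finset.sum_mul_sum]
      refine Finset.sum_congr rfl fun S hS => Finset.sum_congr rfl fun B _ => ?_
      rw [card_adjoinRow (mem_triangularCovers.mp hS).fst_lt, pow_add]
    have h := Finset.sum_sdiff hsub (f := fun x => (p - 1) ^ (adjoinRow m x).card)
    rw [hsum J (fun j hj => by have := hJ j hj; lia), hsum (insert m J)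
      (fun j hj => by rcases Finset.mem_insert.mp hj with rfl | hj
                      · exact le_rfl
                      · have := hJ j hj; lia), Finset.card_insert_of_notMem hm] at h
    rw [sum_triangularCovers_succ hJ, eq_sub_of_add_eq h]
    rfl

/-- The functions `Fin n → α` with range `S`. -/
noncomputable def functionsOnto {α : Type*} [DecidableEq α] (n : ℕ) (S : Finset α) :
    Finset (Fin n → α) :=
  {f ∈ Fintype.piFinset fun _ : Fin n => S | Finset.univ.image f = S}

theorem mem_functionsOnto {α : Type*} [DecidableEq α] {n : ℕ} {S : Finset α} {f : Fin n → α} :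
    f ∈ functionsOnto n S ↔ Finset.univ.image f = S := by
  rw [functionsOnto, Finset.mem_filter, and_iff_right_iff_imp]
  rintro rfl
  simp [Fintype.mem_piFinset]

theorem sum_card_functionsOnto {α : Type*} [DecidableEq α] (n : ℕ) (S : Finset α) :
    ∑ T ∈ S.powerset, (functionsOnto n T).card = S.card ^ n := by
  have hmaps : Set.MapsTo (fun f : Fin n → α => Finset.univ.image f)
      (Fintype.piFinset fun _ : Fin n => S) S.powerset := by
    intro f hf
    rw [Finset.mem_coe, Fintype.mem_piFinset] at hf
    rw [Finset.mem_coe, Finset.mem_powerset, Finset.image_subset_iff]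
    exact fun a _ => hf a
  have hcard : (Fintype.piFinset fun _ : Fin n => S).card = S.card ^ n := by simp
  rw [← hcard, Finset.card_eq_sum_card_fiberwise hmaps]
  refine Finset.sum_congr rfl fun T hT => congrArg Finset.card ?_
  ext f
  rw [mem_functionsOnto, Finset.mem_filter, iff_and_self]
  rintro rfl
  rw [Fintype.mem_piFinset]
  exact fun a => Finset.mem_powerset.mp hT (Finset.mem_image_of_mem f (Finset.mem_univ a))

theorem card_functionsOnto {α : Type*} [DecidableEq α] (n : ℕ) (S : Finset α) :
    ((functionsOnto n S).card : ℝ) =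
      n.factorial * PowerSeries.coeff n ((expSeries (1 : ℝ) - 1) ^ S.card) := by
  induction S using Finset.strongInduction with
  | H S ih =>
    have h1 := congrArg (Nat.cast (R := ℝ)) (sum_card_functionsOnto n S)
    have h2 := congrArg (fun F : PowerSeries ℝ => (n.factorial : ℝ) * PowerSeries.coeff n F)
      (Finset.sum_pow_mul_eq_add_pow (expSeries (1 : ℝ) - 1) 1 S)
    have hmem : S ∈ S.powerset := Finset.mem_powerset_self S
    simp only [one_pow, mul_one, sub_add_cancel, map_sum, Finset.mul_sum] at h2
    rw [← Finset.add_sum_erase _ _ hmem] at h1 h2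
    push_cast at h1
    have h3 : ∑ T ∈ S.powerset.erase S, ((functionsOnto n T).card : ℝ) =
        ∑ T ∈ S.powerset.erase S,
          (n.factorial : ℝ) * PowerSeries.coeff n ((expSeries (1 : ℝ) - 1) ^ T.card) := by
      refine Finset.sum_congr rfl fun T hT => ih T ?_
      rw [Finset.mem_erase, Finset.mem_powerset] at hT
      exact hT.2.ssubset_of_ne hT.1
    have h4 : expSeries (1 : ℝ) ^ S.card = expSeries (S.card : ℝ) := by
      rw [← expSeries_nsmul, mul_one]
    have h5 : (n.factorial : ℝ) * (S.card ^ n * (1 / n.factorial)) = S.card ^ n := by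
      field_simp
    simp only [h4, coeff_expSeries, eq_ratCast, Rat.cast_div, Rat.cast_one, Rat.cast_natCast,
      h5] at h2
    linarith

theorem card_canonicalReps (n m : ℕ) :
    (canonicalReps n m).card = ∑ S ∈ triangularCovers m ∅, (functionsOnto n S).card := by
  have himage (f : Fin n → ℕ × ℕ) :
      Finset.univ.image f ∈ triangularCovers m ∅ ↔ IsCanonicalRep m f := by
    rw [mem_triangularCovers]
    constructor
    · rintro ⟨h1, h2, h3, h4, h5⟩
      simp at h1 h2 h3 h4 h5
      exact ⟨h2, h3, h4, h5⟩
    · rintro ⟨h1, h2, h3, h4⟩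
      refine ⟨?_, ?_, ?_, ?_, ?_⟩ <;> simp <;> grind
  have hmaps : Set.MapsTo (fun f : Fin n → ℕ × ℕ => Finset.univ.image f)
      (canonicalReps n m) (triangularCovers m ∅) := by
    intro f hf
    exact (himage f).mpr (mem_canonicalReps.mp hf)
  rw [Finset.card_eq_sum_card_fiberwise hmaps]
  refine Finset.sum_congr rfl fun S hS => congrArg Finset.card ?_
  ext f
  rw [mem_functionsOnto, Finset.mem_filter, mem_canonicalReps]
  refine ⟨fun h => h.2, fun h => ⟨(himage f).mp (h ▸ hS), h⟩⟩

theorem labelledIntervalOrderCount_eq_coeff (n : ℕ) :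
    (labelledIntervalOrderCount n : ℝ) = n.factorial * PowerSeries.coeff n
      (∑ m ∈ Finset.range (n + 2), triangularWeight (expSeries (1 : ℝ)) m 0) := by
  rw [labelledIntervalOrderCount_eq_sum n (n + 2) (by lia), map_sum, Finset.mul_sum, Nat.cast_sum]
  refine Finset.sum_congr rfl fun m _ => ?_
  rw [card_canonicalReps, Nat.cast_sum, ← Finset.card_empty (α := ℕ),
    ← sum_triangularCovers_pow _ m ∅ (by simp), map_sum, Finset.mul_sum]
  exact Finset.sum_congr rfl fun S _ => card_functionsOnto n S

theorem labelledIntervalOrderCount_eq_sum_abelMoment (n : ℕ) :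
    (labelledIntervalOrderCount n : ℝ) =
      (∑ j ∈ Finset.range (n + 1), n.choose j * ((-1) ^ (j + 1) * abelMoment (2 * j + 1))) /
        (2 * 24 ^ n) := by
  have hpq : expSeries (1 : ℝ) * expSeries (-1) = 1 := by
    rw [← expSeries_add, add_neg_cancel, expSeries_zero]
  have hp : PowerSeries.X ∣ expSeries (1 : ℝ) - 1 := by
    rw [← dvd_neg, neg_sub]
    exact X_dvd_one_sub_expSeries 1
  have h := PowerSeries.X_pow_dvd_iff.mp (pow_dvd_sum_triangularWeight_sub hpq hp (n + 2)) n
    (by lia)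
  rw [map_sub, sub_eq_zero] at h
  rw [labelledIntervalOrderCount_eq_coeff, h, coeff_sum_prod_one_sub n (n + 2) le_rfl,
    abelFunctional_theta]
  field_simp

end Counting

section Asymptotics

open Real

/-- The leading term of `abelMoment (2 * j + 1)`, up to the sign and the factor `√3 / 3`. -/
noncomputable def momentScale (j : ℕ) : ℝ := (2 * j + 1).factorial * (6 / π) ^ (2 * j + 2)

theorem momentScale_pos (j : ℕ) : 0 < momentScale j := by
  unfold momentScale
  positivity

theorem momentScale_succ (j : ℕ) :
    momentScale (j + 1) = momentScale j * ((2 * j + 2) * (2 * j + 3) * (36 / π ^ 2)) := by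
  rw [momentScale, momentScale, show 2 * (j + 1) + 1 = (2 * j + 1) + 1 + 1 by ring,
    Nat.factorial_succ, Nat.factorial_succ]
  push_cast
  rw [show 2 * (j + 1) + 2 = 2 * j + 2 + 2 by ring, pow_add _ _ 2, div_pow _ _ 2]
  ring

theorem choose_mul_momentScale_succ {n j : ℕ} (hj : j < n) :
    (n.choose (j + 1) : ℝ) * momentScale (j + 1) =
      n.choose j * momentScale j * ((n - j) * (2 * (2 * j + 3)) * (36 / π ^ 2)) := by
  have h := congrArg (Nat.cast (R := ℝ)) (Nat.choose_succ_right_eq n j)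
  push_cast [hj.le] at h
  rw [momentScale_succ]
  linear_combination (momentScale j * (2 * (2 * j + 3) * (36 / π ^ 2))) * h

theorem one_le_thirtysix_div_pi_sq : 1 ≤ 36 / π ^ 2 := by
  rw [one_le_div (by positivity)]
  nlinarith [pi_pos, pi_le_four]

theorem mul_choose_mul_momentScale_le {n j : ℕ} (hj : j < n) :
    2 * (j + 1 : ℝ) * (n.choose j * momentScale j) ≤ n.choose (j + 1) * momentScale (j + 1) := by
  rw [choose_mul_momentScale_succ hj, mul_comm]
  have hD : 0 ≤ n.choose j * momentScale j := mul_nonneg (by positivity) (momentScale_pos j).le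
  refine mul_le_mul_of_nonneg_left ?_ hD
  have h1 : (1 : ℝ) ≤ n - j := by
    have : (j + 1 : ℝ) ≤ n := by exact_mod_cast hj
    linarith
  have hj0 : (0 : ℝ) ≤ j := by positivity
  calc (2 * (j + 1) : ℝ) ≤ 1 * (2 * (2 * j + 3)) * 1 := by linarith
    _ ≤ _ := by
      have := one_le_thirtysix_div_pi_sq
      gcongr

theorem sum_choose_mul_momentScale_le_of_le {n k : ℕ} (hk : k ≤ n) :
    ∑ j ∈ Finset.range k, n.choose j * momentScale j ≤ n.choose k * momentScale k := by
  induction k with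
  | zero => simpa using (momentScale_pos 0).le
  | succ k ih =>
    have h1 := ih (by lia)
    have h2 := mul_choose_mul_momentScale_le (n := n) (j := k) hk
    have hD : 0 ≤ n.choose k * momentScale k := mul_nonneg (by positivity) (momentScale_pos k).le
    have hk0 : (0 : ℝ) ≤ k := by positivity
    rw [Finset.sum_range_succ]
    nlinarith

theorem sum_choose_mul_momentScale_le {n : ℕ} (hn : 1 ≤ n) :
    ∑ j ∈ Finset.range n, n.choose j * momentScale j ≤ momentScale n / n := by
  obtain ⟨k, rfl⟩ := Nat.exists_eq_add_of_le' hn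
  have h1 := sum_choose_mul_momentScale_le_of_le (n := k + 1) (k := k) (by lia)
  have h2 := mul_choose_mul_momentScale_le (n := k + 1) (j := k) (by lia)
  rw [Nat.choose_self, Nat.cast_one, one_mul] at h2
  rw [Finset.sum_range_succ, le_div_iff₀ (by positivity)]
  push_cast
  have hk0 : (0 : ℝ) ≤ k + 1 := by positivity
  nlinarith [mul_le_mul_of_nonneg_right h1 hk0]

theorem abs_signed_abelMoment_le (j : ℕ) :
    |(-1) ^ (j + 1) * abelMoment (2 * j + 1)| ≤ momentScale j * (√3 / 3 + π ^ 2 / 9) := by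
  have h := abs_abelMoment_sub_le j
  rw [← momentScale] at h
  have hpos := momentScale_pos j
  have hle : momentScale j * ((1 / 4) ^ j * (π ^ 2 / 9)) ≤ momentScale j * (1 * (π ^ 2 / 9)) := by
    gcongr
    exact pow_le_one₀ (by norm_num) (by norm_num)
  have h0 : 0 ≤ momentScale j * (√3 / 3) := by positivity
  rw [abs_le] at h ⊢
  constructor <;> linarith

theorem abs_sum_choose_mul_abelMoment_sub_le {n : ℕ} (hn : 1 ≤ n) :
    |∑ j ∈ Finset.range (n + 1), n.choose j * ((-1) ^ (j + 1) * abelMoment (2 * j + 1)) -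
      momentScale n * (√3 / 3)| ≤ momentScale n * (√3 / 3 + 2 * π ^ 2 / 9) / n := by
  have hn0 : (0 : ℝ) < n := by exact_mod_cast hn
  rw [Finset.sum_range_succ, Nat.choose_self, Nat.cast_one, one_mul, add_sub_assoc]
  have hlow : |∑ j ∈ Finset.range n, n.choose j * ((-1) ^ (j + 1) * abelMoment (2 * j + 1))| ≤
      momentScale n / n * (√3 / 3 + π ^ 2 / 9) := by
    calc _ ≤ ∑ j ∈ Finset.range n, |n.choose j * ((-1) ^ (j + 1) * abelMoment (2 * j + 1))| :=
          Finset.abs_sum_le_sum_abs _ _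
      _ ≤ ∑ j ∈ Finset.range n, n.choose j * momentScale j * (√3 / 3 + π ^ 2 / 9) := by
          refine Finset.sum_le_sum fun j _ => ?_
          rw [abs_mul, Nat.abs_cast, mul_assoc]
          exact mul_le_mul_of_nonneg_left (abs_signed_abelMoment_le j) (Nat.cast_nonneg _)
      _ ≤ _ := by
          rw [← Finset.sum_mul]
          exact mul_le_mul_of_nonneg_right (sum_choose_mul_momentScale_le hn) (by positivity)
  have htop := abs_abelMoment_sub_le n
  rw [← momentScale] at htop
  have hpow : ((1 : ℝ) / 4) ^ n ≤ 1 / n := by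
    rw [one_div_pow]
    refine one_div_le_one_div_of_le hn0 ?_
    exact_mod_cast (Nat.lt_pow_self (by norm_num)).le
  have hpos := momentScale_pos n
  have htop' : momentScale n * ((1 / 4) ^ n * (π ^ 2 / 9)) ≤
      momentScale n * (1 / n * (π ^ 2 / 9)) := by gcongr
  calc _ ≤ _ := abs_add_le _ _
    _ ≤ momentScale n / n * (√3 / 3 + π ^ 2 / 9) + momentScale n * (1 / n * (π ^ 2 / 9)) :=
        add_le_add hlow (htop.trans htop')
    _ = _ := by ring

/-- The central factor `(2n + 1)! / (n!² 4ⁿ √n)`. -/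
noncomputable def wallisRatio (n : ℕ) : ℝ :=
  (2 * n + 1).factorial / ((n.factorial : ℝ) ^ 2 * 4 ^ n * √n)

theorem wallisRatio_sq {n : ℕ} (hn : 1 ≤ n) :
    wallisRatio n ^ 2 = (2 * n + 1) / (n * Wallis.W n) := by
  have hn0 : (0 : ℝ) < n := by exact_mod_cast hn
  have hf : (2 ^ (4 * n) : ℝ) = (4 ^ n) ^ 2 := by
    rw [← pow_mul, mul_comm n 2, pow_mul, pow_mul]
    norm_num
  rw [wallisRatio, Wallis.W_eq_factorial_ratio, Nat.factorial_succ, hf, div_pow, mul_pow,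
    sq_sqrt hn0.le]
  push_cast
  field_simp

theorem abs_wallisRatio_sub_le {n : ℕ} (hn : 1 ≤ n) :
    |wallisRatio n - 2 / √π| ≤ 2 / √π / n := by
  have hn0 : (0 : ℝ) < n := by exact_mod_cast hn
  have hsq := wallisRatio_sq hn
  have hpos : 0 ≤ wallisRatio n := by
    unfold wallisRatio
    positivity
  have hW := Wallis.W_pos n
  have hconst : (2 / √π) ^ 2 = 4 / π := by
    rw [div_pow, sq_sqrt pi_pos.le]
    norm_num
  have hlow : 2 / √π ≤ wallisRatio n := by
    refine le_of_pow_le_pow_left₀ two_ne_zero hpos ?_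
    rw [hsq, hconst, le_div_iff₀ (by positivity)]
    calc 4 / π * (n * Wallis.W n) ≤ 4 / π * (n * (π / 2)) := by
          gcongr
          exact Wallis.W_le n
      _ = 2 * n := by
          field_simp
          norm_num
      _ ≤ 2 * n + 1 := by linarith
  have hup : wallisRatio n ≤ 2 / √π * (1 + 1 / n) := by
    refine le_of_pow_le_pow_left₀ two_ne_zero (by positivity) ?_
    rw [hsq, mul_pow, hconst, div_le_iff₀ (by positivity)]
    calc (2 * n + 1 : ℝ) ≤ (1 + 1 / n) * (2 * n + 1) :=
          le_mul_of_one_le_left (by positivity) (by simp)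
      _ = 4 / π * (1 + 1 / n) ^ 2 * (n * ((2 * n + 1) / (2 * n + 2) * (π / 2))) := by
          field_simp
          ring
      _ ≤ _ := by
          gcongr
          exact Wallis.le_W n
  rw [abs_le]
  constructor
  · have : 0 ≤ 2 / √π / n := by positivity
    linarith
  · linarith [show 2 / √π * (1 + 1 / n) = 2 / √π + 2 / √π / n by ring]

theorem momentScale_div (n : ℕ) :
    momentScale n / (2 * 24 ^ n) / ((n.factorial : ℝ) ^ 2 * √n * (6 / π ^ 2) ^ n) =
      18 / π ^ 2 * wallisRatio n := by
  have h24 : (36 : ℝ) ^ n = 24 ^ n * 6 ^ n / 4 ^ n := by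
    rw [← mul_pow, ← div_pow]
    norm_num
  rw [momentScale, wallisRatio, pow_add, pow_mul, div_pow 6 π 2, div_pow _ (π ^ 2),
    div_pow _ (π ^ 2)]
  norm_num [h24]
  field_simp
  ring

end Asymptotics

/-- There is a constant `C` with
`|ℓ_n / ((n!)² √n (6/π²)^n) - 12√3/π^{5/2}| ≤ C / n` for all `n ≥ 1`; that is,
`ℓ_n = (12√3/π^{5/2}) (n!)² √n (6/π²)^n (1 + O(1/n))`. -/
theorem labelled_asymptotics :
    ∃ C : ℝ, ∀ n : ℕ, 1 ≤ n →
      |(labelledIntervalOrderCount n : ℝ) /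
          ((n.factorial : ℝ) ^ 2 * Real.sqrt n * (6 / Real.pi ^ 2) ^ n) -
        12 * Real.sqrt 3 / Real.pi ^ ((5 : ℝ) / 2)| ≤ C / n := by
  set K : ℝ := √3 / 3 + 2 * Real.pi ^ 2 / 9 with hK
  have hK0 : 0 ≤ K := by positivity
  set c : ℝ := 2 / √Real.pi with hc
  have hc0 : 0 ≤ c := by positivity
  refine ⟨18 / Real.pi ^ 2 * (2 * c * K + √3 / 3 * c), fun n hn => ?_⟩
  have hn0 : (0 : ℝ) < n := by exact_mod_cast hn
  have hpi : Real.pi ^ ((5 : ℝ) / 2) = Real.pi ^ 2 * √Real.pi := by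
    rw [Real.sqrt_eq_rpow, ← Real.rpow_natCast, ← Real.rpow_add Real.pi_pos]
    norm_num
  set d : ℝ := (n.factorial : ℝ) ^ 2 * √n * (6 / Real.pi ^ 2) ^ n with hd
  have hd0 : 0 < d := by positivity
  have hR := abs_wallisRatio_sub_le hn
  rw [← hc] at hR
  have hR2 : wallisRatio n ≤ 2 * c := by
    have : c / n ≤ c := div_le_self hc0 (by exact_mod_cast hn)
    linarith [(abs_le.mp hR).2]
  have hscale : momentScale n / (2 * 24 ^ n) / d = 18 / Real.pi ^ 2 * wallisRatio n :=
    momentScale_div n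
  have hmain : |(labelledIntervalOrderCount n : ℝ) / d -
      18 / Real.pi ^ 2 * wallisRatio n * (√3 / 3)| ≤ 18 / Real.pi ^ 2 * (2 * c) * K / n := by
    have hpos : (0 : ℝ) < 2 * 24 ^ n * d := by positivity
    have h := div_le_div_of_nonneg_right (abs_sum_choose_mul_abelMoment_sub_le hn) hpos.le
    rw [← abs_of_pos hpos, ← abs_div, abs_of_pos hpos] at h
    rw [← hscale, labelledIntervalOrderCount_eq_sum_abelMoment]
    calc _ = _ := congrArg abs (by ring)
      _ ≤ _ := h
      _ = 18 / Real.pi ^ 2 * wallisRatio n * K / n := by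
        rw [← hscale]
        ring
      _ ≤ _ := by gcongr
  have hlim : 12 * √3 / Real.pi ^ ((5 : ℝ) / 2) = 18 / Real.pi ^ 2 * c * (√3 / 3) := by
    rw [hpi, hc]
    field_simp
    norm_num
  have hrest : |18 / Real.pi ^ 2 * wallisRatio n * (√3 / 3) - 18 / Real.pi ^ 2 * c * (√3 / 3)| ≤
      18 / Real.pi ^ 2 * (√3 / 3) * (c / n) := by
    rw [show 18 / Real.pi ^ 2 * wallisRatio n * (√3 / 3) - 18 / Real.pi ^ 2 * c * (√3 / 3) =
      18 / Real.pi ^ 2 * (√3 / 3) * (wallisRatio n - c) by ring, abs_mul, abs_of_nonneg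
      (by positivity)]
    gcongr
  rw [hlim]
  calc _ ≤ _ := abs_sub_le _ (18 / Real.pi ^ 2 * wallisRatio n * (√3 / 3)) _
    _ ≤ _ := add_le_add hmain hrest
    _ = _ := by ring
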